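/- arXiv:2309.11185 — 2 statements merged into one kernel-verified Lean document; each statement's English description precedes it below -/
import Mathlib

section
/- (Differential equation for the GOE moment generating function, τ = 1.) For every even integer N ≥ 2, the function M_1(t) satisfies Σ_{k=0}^{4} C_k(t)·M_1^{(k)}(t) = 0 for all t ∈ ℝ, where C_4(t) = t, C_3(t) = 5, C_2(t) = −5t³−(8N−4)t, C_1(t) = −36t²−20N+10, C_0(t) = 4t⁵+(20N−10)t³+(16N²−16N−44)t. -/
open Real MeasureTheory Finset

/-- The rescaled (monic-type) Hermite polynomials `C_k` with parameter `τ`: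
`C_0(x) = 1`, `C_1(x) = x`, `C_{k+1}(x) = x·C_k(x) − k·τ·C_{k−1}(x)`. -/
noncomputable def CH (τ : ℝ) : ℕ → ℝ → ℝ
  | 0 => fun _ => 1
  | 1 => fun x => x
  | (k+2) => fun x => x * CH τ (k+1) x - ((k : ℝ) + 1) * τ * CH τ k x

/-- The elliptic GinUE part `R_N^{(1)}` of the real-eigenvalue density. -/
noncomputable def R1 (τ : ℝ) (N : ℕ) (x : ℝ) : ℝ :=
  (Real.exp (-x^2/(1+τ)) / Real.sqrt (2*Real.pi)) *
    ∑ k ∈ Finset.range (N-1), (CH τ k x)^2 / (Nat.factorial k : ℝ)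

/-- The correction part `R_N^{(2)}` of the real-eigenvalue density. -/
noncomputable def R2 (τ : ℝ) (N : ℕ) (x : ℝ) : ℝ :=
  (1/((1+τ) * (Nat.factorial (N-2) : ℝ))) * (Real.exp (-x^2/(2*(1+τ))) / Real.sqrt (2*Real.pi)) *
    CH τ (N-1) x * (∫ u in (0:ℝ)..x, Real.exp (-u^2/(2*(1+τ))) * CH τ (N-2) u)

/-- The density `R_N` of real eigenvalues of the elliptic GinOE. -/
noncomputable def Rd (τ : ℝ) (N : ℕ) (x : ℝ) : ℝ := R1 τ N x + R2 τ N x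

/-- The moment generating function of real eigenvalues of the elliptic GinOE. -/
noncomputable def MGF (τ : ℝ) (N : ℕ) (t : ℝ) : ℝ := ∫ x : ℝ, Real.exp (t*x) * Rd τ N x

/-- The `p`-th spectral moment of real eigenvalues of the elliptic GinOE. -/
noncomputable def Mom (τ : ℝ) (N : ℕ) (p : ℕ) : ℝ := ∫ x : ℝ, x^p * Rd τ N x

/-- The elliptic GinUE part `u` of the moment generating function. -/
noncomputable def uF (τ : ℝ) (N : ℕ) (t : ℝ) : ℝ := ∫ x : ℝ, Real.exp (t*x) * R1 τ N x

/-- The part `v` of the moment generating function coming from `R_N^{(2)}`. -/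
noncomputable def vF (τ : ℝ) (N : ℕ) (t : ℝ) : ℝ := ∫ x : ℝ, Real.exp (t*x) * R2 τ N x

/-- All two-sided exponential moments of `f` exist. -/
def HasExpMoments (f : ℝ → ℝ) : Prop := ∀ s : ℝ, Integrable fun x => exp (s * x) * f x

namespace HasExpMoments

variable {f g : ℝ → ℝ}

lemma integrable (hf : HasExpMoments f) : Integrable f := by
  simpa using hf 0

lemma add (hf : HasExpMoments f) (hg : HasExpMoments g) :
    HasExpMoments fun x => f x + g x := fun s => by
  simpa only [mul_add] using! (hf s).add (hg s)

lemma const_mul (c : ℝ) (hf : HasExpMoments f) : HasExpMoments fun x => c * f x := fun s => by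
  simpa only [mul_left_comm] using (hf s).const_mul c

lemma bounded_mul {B : ℝ} (hf : HasExpMoments f) (hg : Continuous g) (hB : ∀ x, |g x| ≤ B) :
    HasExpMoments fun x => g x * f x := fun s => by
  simpa only [mul_left_comm] using
    (hf s).bdd_mul (c := B) hg.aestronglyMeasurable (Filter.Eventually.of_forall hB)

lemma abs_mul_exp_le {s t : ℝ} (h : |s - t| ≤ 1) (x : ℝ) :
    |x| * exp (s * x) ≤ exp ((t + 2) * x) + exp ((t - 2) * x) := by
  have hx : |x| ≤ exp |x| := (lt_add_one _).le.trans (add_one_le_exp _)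
  have hs : s * x ≤ t * x + |x| := by
    have := (le_abs_self _).trans ((abs_mul (s - t) x).le.trans
      (mul_le_mul_of_nonneg_right h (abs_nonneg x)))
    linarith
  have key : |x| * exp (s * x) ≤ exp (t * x + 2 * |x|) := by
    calc |x| * exp (s * x) ≤ exp |x| * exp (t * x + |x|) := by gcongr
      _ = exp (t * x + 2 * |x|) := by rw [← exp_add]; ring_nf
  refine key.trans ?_
  rcases abs_cases x with ⟨h, -⟩ | ⟨h, -⟩ <;> rw [h]
  · have : t * x + 2 * x = (t + 2) * x := by ring
    rw [this]
    exact le_add_of_nonneg_right (exp_pos _).le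
  · have : t * x + 2 * -x = (t - 2) * x := by ring
    rw [this]
    exact le_add_of_nonneg_left (exp_pos _).le

lemma integrable_majorant (hf : HasExpMoments f) (t : ℝ) :
    Integrable fun x => (exp ((t + 2) * x) + exp ((t - 2) * x)) * |f x| := by
  refine ((hf (t + 2)).norm.add (hf (t - 2)).norm).congr (Filter.Eventually.of_forall fun x => ?_)
  simp [add_mul]

lemma id_mul (hf : HasExpMoments f) : HasExpMoments fun x => x * f x := fun s => by
  refine (hf.integrable_majorant s).mono' ?_ (Filter.Eventually.of_forall fun x => ?_)
  · have := hf.integrable.aestronglyMeasurable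
    fun_prop
  · rw [norm_mul, norm_mul, norm_eq_abs, norm_eq_abs, norm_eq_abs, abs_exp, ← mul_assoc,
      mul_comm (exp _)]
    exact mul_le_mul_of_nonneg_right (abs_mul_exp_le (by simp) x) (abs_nonneg _)

lemma pow_mul (k : ℕ) (hf : HasExpMoments f) : HasExpMoments fun x => x ^ k * f x := by
  induction k with
  | zero => simpa using hf
  | succ k ih => simpa only [pow_succ', mul_assoc] using ih.id_mul

lemma polynomial_mul (p : Polynomial ℝ) (hf : HasExpMoments f) :
    HasExpMoments fun x => p.eval x * f x := by
  induction p using Polynomial.induction_on' with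
  | add p q hp hq => simpa only [Polynomial.eval_add, add_mul] using hp.add hq
  | monomial k c =>
    simpa only [Polynomial.eval_monomial, mul_assoc] using (hf.pow_mul k).const_mul c

lemma CH_mul (τ : ℝ) (hf : HasExpMoments f) (k : ℕ) : HasExpMoments fun x => CH τ k x * f x := by
  induction k using Nat.twoStepInduction with
  | zero => simpa [CH] using hf
  | one => simpa [CH] using hf.id_mul
  | more k h₀ h₁ =>
    convert h₁.id_mul.add (h₀.const_mul (-(((k : ℝ) + 1) * τ))) using 2 with x
    simp only [CH]
    ring

/-- Differentiation under the integral sign for two-sided Laplace transforms. -/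
lemma hasDerivAt_integral (hf : HasExpMoments f) (t : ℝ) :
    HasDerivAt (fun s => ∫ x, exp (s * x) * f x) (∫ x, exp (t * x) * (x * f x)) t := by
  refine (hasDerivAt_integral_of_dominated_loc_of_deriv_le
    (F' := fun s x => exp (s * x) * (x * f x)) (Metric.ball_mem_nhds t one_pos)
    (Filter.Eventually.of_forall fun s => (hf s).aestronglyMeasurable) (hf t)
    (hf.id_mul t).aestronglyMeasurable (Filter.Eventually.of_forall fun x s hs => ?_)
    (hf.integrable_majorant t) (Filter.Eventually.of_forall fun x s _ => ?_)).2
  · rw [norm_mul, norm_mul, norm_eq_abs, norm_eq_abs, norm_eq_abs, abs_exp, ← mul_assoc,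
      mul_comm (exp _)]
    refine mul_le_mul_of_nonneg_right (abs_mul_exp_le ?_ x) (abs_nonneg _)
    exact (mem_ball_iff_norm.1 hs).le
  · refine (((hasDerivAt_id' s).mul_const x).exp.mul_const (f x)).congr_deriv ?_
    ring

lemma iteratedDeriv_integral (hf : HasExpMoments f) (k : ℕ) :
    iteratedDeriv k (fun s => ∫ x, exp (s * x) * f x) =
      fun s => ∫ x, exp (s * x) * (x ^ k * f x) := by
  induction k with
  | zero => simp
  | succ k ih =>
    rw [iteratedDeriv_succ, ih]
    funext s
    simpa only [pow_succ', mul_assoc] using ((hf.pow_mul k).hasDerivAt_integral s).deriv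

end HasExpMoments

lemma hasExpMoments_gaussian : HasExpMoments fun x => exp (-x ^ 2 / 4) := fun s => by
  refine (((integrable_exp_neg_mul_sq (b := 1 / 4) (by norm_num)).comp_sub_right
    (2 * s)).const_mul (exp (s ^ 2))).congr (Filter.Eventually.of_forall fun x => ?_)
  simp only
  rw [← exp_add, ← exp_add]
  ring_nf

lemma hasDerivAt_CH_one (n : ℕ) (x : ℝ) :
    HasDerivAt (CH 1 n) (x * CH 1 n x - CH 1 (n + 1) x) x ∧
      HasDerivAt (CH 1 (n + 1)) (((n : ℝ) + 1) * CH 1 n x) x := by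
  induction n with
  | zero =>
    refine ⟨?_, ?_⟩
    · simpa [CH] using hasDerivAt_const x (1 : ℝ)
    · simpa [CH] using hasDerivAt_id' x
  | succ n ih =>
    refine ⟨ih.2.congr_deriv ?_, ?_⟩
    · simp only [CH]
      ring
    · refine (((hasDerivAt_id x).mul ih.2).sub (ih.1.const_mul (((n : ℝ) + 1) * 1))).congr_deriv ?_
      simp only [id]
      push_cast
      ring

/-- Confluent Christoffel–Darboux formula for the monic Hermite polynomials. -/
lemma sum_CH_one_sq (n : ℕ) (x : ℝ) :
    ∑ k ∈ range (n + 1), CH 1 k x ^ 2 / (k.factorial : ℝ) =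
      (((n : ℝ) + 1) * CH 1 n x ^ 2 - x * CH 1 (n + 1) x * CH 1 n x + CH 1 (n + 1) x ^ 2) /
        n.factorial := by
  induction n with
  | zero => simp [CH]; ring
  | succ n ih =>
    have h : (n.factorial : ℝ) ≠ 0 := by positivity
    have h' : (n : ℝ) + 1 ≠ 0 := by positivity
    rw [sum_range_succ, ih, Nat.factorial_succ]
    simp only [CH]
    push_cast
    field_simp
    ring

/-- The Hermite function `exp (-x² / 4) * He_n x`. -/
noncomputable def hermiteFn (n : ℕ) (x : ℝ) : ℝ := exp (-x ^ 2 / 4) * CH 1 n x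

/-- The primitive of `hermiteFn n` vanishing at the origin. -/
noncomputable def hermiteFnPrimitive (n : ℕ) (x : ℝ) : ℝ := ∫ u in (0 : ℝ)..x, hermiteFn n u

/-- The density `Rd 1 (n + 2)` up to a constant factor. -/
noncomputable def goeDensity (n : ℕ) (x : ℝ) : ℝ :=
  ((n : ℝ) + 1) * hermiteFn n x ^ 2 - x * hermiteFn (n + 1) x * hermiteFn n x
    + hermiteFn (n + 1) x ^ 2 + hermiteFn (n + 1) x * hermiteFnPrimitive n x / 2

lemma hasDerivAt_gaussian (x : ℝ) :
    HasDerivAt (fun y : ℝ => exp (-y ^ 2 / 4)) (-x / 2 * exp (-x ^ 2 / 4)) x := by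
  refine (((hasDerivAt_id x).pow 2).neg.div_const 4).exp.congr_deriv ?_
  simp
  ring

lemma hasDerivAt_hermiteFn (n : ℕ) (x : ℝ) :
    HasDerivAt (hermiteFn n) (x / 2 * hermiteFn n x - hermiteFn (n + 1) x) x := by
  refine ((hasDerivAt_gaussian x).mul (hasDerivAt_CH_one n x).1).congr_deriv ?_
  simp only [hermiteFn]
  ring

lemma hasDerivAt_hermiteFn_succ (n : ℕ) (x : ℝ) :
    HasDerivAt (hermiteFn (n + 1))
      (-x / 2 * hermiteFn (n + 1) x + ((n : ℝ) + 1) * hermiteFn n x) x := by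
  refine ((hasDerivAt_gaussian x).mul (hasDerivAt_CH_one n x).2).congr_deriv ?_
  simp only [hermiteFn]
  ring

lemma continuous_hermiteFn (n : ℕ) : Continuous (hermiteFn n) :=
  continuous_iff_continuousAt.2 fun x => (hasDerivAt_hermiteFn n x).continuousAt

lemma hasDerivAt_hermiteFnPrimitive (n : ℕ) (x : ℝ) :
    HasDerivAt (hermiteFnPrimitive n) (hermiteFn n x) x :=
  intervalIntegral.integral_hasDerivAt_right ((continuous_hermiteFn n).intervalIntegrable _ _)
    ((continuous_hermiteFn n).stronglyMeasurableAtFilter _ _)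
    (continuous_hermiteFn n).continuousAt

lemma hasExpMoments_hermiteFn (n : ℕ) : HasExpMoments (hermiteFn n) := by
  convert hasExpMoments_gaussian.CH_mul 1 n using 2 with x
  exact mul_comm _ _

lemma abs_hermiteFnPrimitive_le (n : ℕ) (x : ℝ) :
    |hermiteFnPrimitive n x| ≤ ∫ u, |hermiteFn n u| := by
  have h : Integrable fun u => |hermiteFn n u| := (hasExpMoments_hermiteFn n).integrable.abs
  rw [← norm_eq_abs, hermiteFnPrimitive]
  refine intervalIntegral.norm_integral_le_integral_norm_uIoc.trans ?_
  exact setIntegral_le_integral h (Filter.Eventually.of_forall fun u => abs_nonneg _)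

lemma hasExpMoments_hermiteFn_mul_primitive (m n : ℕ) :
    HasExpMoments fun x => hermiteFn m x * hermiteFnPrimitive n x := by
  have hc : Continuous (hermiteFnPrimitive n) :=
    continuous_iff_continuousAt.2 fun x => (hasDerivAt_hermiteFnPrimitive n x).continuousAt
  simpa only [mul_comm] using
    (hasExpMoments_hermiteFn m).bounded_mul hc (abs_hermiteFnPrimitive_le n)

lemma hasExpMoments_hermiteFn_mul (m n : ℕ) :
    HasExpMoments fun x => hermiteFn m x * hermiteFn n x := by
  have hb : ∀ x : ℝ, |exp (-x ^ 2 / 4)| ≤ 1 := fun x => by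
    rw [abs_exp, exp_le_one_iff]
    nlinarith [sq_nonneg x]
  have := ((hasExpMoments_hermiteFn n).bounded_mul (by fun_prop) hb).CH_mul 1 m
  convert this using 2 with x
  simp only [hermiteFn]
  ring

lemma hasExpMoments_goeDensity (n : ℕ) : HasExpMoments (goeDensity n) := by
  convert ((((hasExpMoments_hermiteFn_mul n n).const_mul ((n : ℝ) + 1)).add
    ((hasExpMoments_hermiteFn_mul (n + 1) n).id_mul.const_mul (-1))).add
    (hasExpMoments_hermiteFn_mul (n + 1) (n + 1))).add
    ((hasExpMoments_hermiteFn_mul_primitive (n + 1) n).const_mul (1 / 2)) using 2 with x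
  simp only [goeDensity]
  ring

lemma Rd_one_eq (n : ℕ) (x : ℝ) :
    Rd 1 (n + 2) x = 1 / (√(2 * π) * n.factorial) * goeDensity n x := by
  have h₁ : exp (-x ^ 2 / (1 + 1)) = exp (-x ^ 2 / 4) ^ 2 := by
    rw [← exp_nat_mul]
    ring_nf
  have h₂ : ∀ u : ℝ, -u ^ 2 / (2 * (1 + 1)) = -u ^ 2 / 4 := fun u => by norm_num
  simp only [Rd, R1, R2, goeDensity, hermiteFnPrimitive, hermiteFn, h₁, h₂, Nat.add_sub_cancel,
    show n + 2 - 1 = n + 1 from rfl, sum_CH_one_sq]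
  have h : (n.factorial : ℝ) ≠ 0 := by positivity
  have h' : √(2 * π) ≠ 0 := by positivity
  field_simp
  ring

lemma MGF_one_eq (n : ℕ) :
    MGF 1 (n + 2) =
      fun s => ∫ x, exp (s * x) * (1 / (√(2 * π) * n.factorial) * goeDensity n x) := by
  funext s
  simp only [MGF, Rd_one_eq]

open Polynomial in
/-- The symbol of the differential operator, times `exp (t * x) * goeDensity n x`, is an exact
derivative in `x`. -/
lemma exists_primitive_symbol_mul_goeDensity (n : ℕ) (t : ℝ) :
    ∃ Q : ℝ → ℝ, HasExpMoments Q ∧ ∀ x, HasDerivAt (fun y => exp (t * y) * Q y)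
      (exp (t * x) * ((t * x ^ 4 + 5 * x ^ 3 + (-5 * t ^ 3 - (8 * ((n : ℝ) + 2) - 4) * t) * x ^ 2
        + (-36 * t ^ 2 - 20 * ((n : ℝ) + 2) + 10) * x
        + (4 * t ^ 5 + (20 * ((n : ℝ) + 2) - 10) * t ^ 3
          + (16 * ((n : ℝ) + 2) ^ 2 - 16 * ((n : ℝ) + 2) - 44) * t)) * goeDensity n x)) x := by
  let p₁ : ℝ[X] := C (4 * t ^ 4 * n + 4 * t ^ 4 + 58 * n + 10 + 20 * t ^ 2 * n ^ 2
    + 50 * t ^ 2 * n + 30 * t ^ 2 + 16 * n ^ 3 + 64 * n ^ 2) + C (-25 * t * n - 25 * t) * X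
    + C (-5 * t ^ 2 * n - 5 * t ^ 2 - 8 * n ^ 2 - 20 * n - 12) * X ^ 2 + C ((n : ℝ) + 1) * X ^ 4
  let p₂ : ℝ[X] := C (2 * t ^ 3 + 8 * t * n + 15 * t)
    + C (-4 * t ^ 4 - 31 * t ^ 2 - 26 - 52 * n - 20 * t ^ 2 * n - 16 * n ^ 2) * X
    + C (23 * t) * X ^ 2 + C (13 + 5 * t ^ 2 + 8 * n) * X ^ 3 + C (-1) * X ^ 5
  let p₃ : ℝ[X] := C (4 * t ^ 4 + 32 * t ^ 2 + 28 + 56 * n + 20 * t ^ 2 * n + 16 * n ^ 2)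
    + C (-25 * t) * X + C (-14 - 5 * t ^ 2 - 8 * n) * X ^ 2 + X ^ 4
  let p₄ : ℝ[X] := C (2 * t ^ 4 + 12 * t ^ 2 + 8 * t ^ 2 * n - 10)
    + C (t ^ 3 - 8 * t + 4 * t * n) * X + C (-2 * t ^ 2 - 5) * X ^ 2 + C (-t) * X ^ 3
  let p₅ : ℝ[X] := C (-2 * t ^ 3 * n - 2 * t ^ 3 - 20 * t * n - 12 * t - 8 * t * n ^ 2)
    + C (10 * (n : ℝ) + 10) * X + C (2 * t * n + 2 * t) * X ^ 2
  let a := hermiteFn (n + 1)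
  let b := hermiteFn n
  let I := hermiteFnPrimitive n
  refine ⟨fun x => p₁.eval x * (b x * b x) + p₂.eval x * (a x * b x) + p₃.eval x * (a x * a x)
    + p₄.eval x * (a x * I x) + p₅.eval x * (b x * I x), ?_, fun x => ?_⟩
  · exact (((((hasExpMoments_hermiteFn_mul n n).polynomial_mul p₁).add
      ((hasExpMoments_hermiteFn_mul (n + 1) n).polynomial_mul p₂)).add
      ((hasExpMoments_hermiteFn_mul (n + 1) (n + 1)).polynomial_mul p₃)).add
      ((hasExpMoments_hermiteFn_mul_primitive (n + 1) n).polynomial_mul p₄)).add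
      ((hasExpMoments_hermiteFn_mul_primitive n n).polynomial_mul p₅)
  · have ha : HasDerivAt a (-x / 2 * a x + ((n : ℝ) + 1) * b x) x := hasDerivAt_hermiteFn_succ n x
    have hb : HasDerivAt b (x / 2 * b x - a x) x := hasDerivAt_hermiteFn n x
    have hI : HasDerivAt I (b x) x := hasDerivAt_hermiteFnPrimitive n x
    have he : HasDerivAt (fun y => exp (t * y)) (exp (t * x) * t) x := by
      simpa using ((hasDerivAt_id x).const_mul t).exp
    refine (he.mul ((((((p₁.hasDerivAt x).mul (hb.mul hb)).add
      ((p₂.hasDerivAt x).mul (ha.mul hb))).add ((p₃.hasDerivAt x).mul (ha.mul ha))).add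
      ((p₄.hasDerivAt x).mul (ha.mul hI))).add
      ((p₅.hasDerivAt x).mul (hb.mul hI)))).congr_deriv ?_
    have hρ : goeDensity n x = ((n : ℝ) + 1) * b x ^ 2 - x * a x * b x + a x ^ 2
      + a x * I x / 2 := rfl
    rw [hρ]
    clear_value a b I
    simp only [p₁, p₂, p₃, p₄, p₅, Pi.add_apply, Pi.mul_apply, derivative_add, derivative_mul,
      derivative_C, derivative_X, derivative_X_pow, eval_add, eval_mul, eval_C, eval_X, eval_pow,
      eval_zero, eval_one]
    push_cast
    ring

/-- **Theorem (Differential equation for the MGF of the GOE, `τ = 1`).**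
For every even integer `N ≥ 2`, `Σ_{k=0}^{4} C_k(t)·M_1^{(k)}(t) = 0` for all `t ∈ ℝ`. -/
theorem GOE_MGF_ODE (N : ℕ) (hNeven : Even N) (hN2 : 2 ≤ N) (t : ℝ) :
    t * iteratedDeriv 4 (MGF 1 N) t
    + 5 * iteratedDeriv 3 (MGF 1 N) t
    + (-5*t^3 - (8*(N:ℝ)-4)*t) * iteratedDeriv 2 (MGF 1 N) t
    + (-36*t^2 - 20*(N:ℝ) + 10) * deriv (MGF 1 N) t
    + (4*t^5 + (20*(N:ℝ)-10)*t^3 + (16*(N:ℝ)^2-16*(N:ℝ)-44)*t) * MGF 1 N t = 0 := by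
  obtain ⟨n, rfl⟩ := Nat.exists_eq_add_of_le' hN2
  obtain ⟨Q, hQ, hQ'⟩ := exists_primitive_symbol_mul_goeDensity n t
  have hf : HasExpMoments fun x => 1 / (√(2 * π) * n.factorial) * goeDensity n x :=
    (hasExpMoments_goeDensity n).const_mul _
  have hρ (k : ℕ) : Integrable fun x => exp (t * x) * (x ^ k * goeDensity n x) :=
    (hasExpMoments_goeDensity n).pow_mul k t
  have hM (k : ℕ) : iteratedDeriv k (MGF 1 (n + 2)) t =
      1 / (√(2 * π) * n.factorial) * ∫ x, exp (t * x) * (x ^ k * goeDensity n x) := by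
    rw [MGF_one_eq, hf.iteratedDeriv_integral, ← integral_const_mul]
    refine integral_congr_ae (Filter.Eventually.of_forall fun x => ?_)
    ring
  have hM₀ := hM 0
  have hM₁ := hM 1
  rw [iteratedDeriv_zero] at hM₀
  rw [iteratedDeriv_one] at hM₁
  have hsum := ((((hρ 4).const_mul t).add ((hρ 3).const_mul 5)).add
    ((hρ 2).const_mul (-5 * t ^ 3 - (8 * ((n : ℝ) + 2) - 4) * t))).add
    ((hρ 1).const_mul (-36 * t ^ 2 - 20 * ((n : ℝ) + 2) + 10)) |>.add
    ((hρ 0).const_mul (4 * t ^ 5 + (20 * ((n : ℝ) + 2) - 10) * t ^ 3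
      + (16 * ((n : ℝ) + 2) ^ 2 - 16 * ((n : ℝ) + 2) - 44) * t))
  have hzero := integral_eq_zero_of_hasDerivAt_of_integrable hQ'
    (hsum.congr (Filter.Eventually.of_forall fun x => by simp only [Pi.add_apply]; ring)) (hQ t)
  have hsplit : ∀ x, exp (t * x) * ((t * x ^ 4 + 5 * x ^ 3
      + (-5 * t ^ 3 - (8 * ((n : ℝ) + 2) - 4) * t) * x ^ 2
      + (-36 * t ^ 2 - 20 * ((n : ℝ) + 2) + 10) * x
      + (4 * t ^ 5 + (20 * ((n : ℝ) + 2) - 10) * t ^ 3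
        + (16 * ((n : ℝ) + 2) ^ 2 - 16 * ((n : ℝ) + 2) - 44) * t)) * goeDensity n x) =
      t * (exp (t * x) * (x ^ 4 * goeDensity n x)) + 5 * (exp (t * x) * (x ^ 3 * goeDensity n x))
      + (-5 * t ^ 3 - (8 * ((n : ℝ) + 2) - 4) * t) * (exp (t * x) * (x ^ 2 * goeDensity n x))
      + (-36 * t ^ 2 - 20 * ((n : ℝ) + 2) + 10) * (exp (t * x) * (x ^ 1 * goeDensity n x))
      + (4 * t ^ 5 + (20 * ((n : ℝ) + 2) - 10) * t ^ 3
        + (16 * ((n : ℝ) + 2) ^ 2 - 16 * ((n : ℝ) + 2) - 44) * t)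
        * (exp (t * x) * (x ^ 0 * goeDensity n x)) := fun x => by ring
  simp only [hsplit] at hzero
  rw [integral_add (by fun_prop) (by fun_prop), integral_add (by fun_prop) (by fun_prop),
    integral_add (by fun_prop) (by fun_prop), integral_add (by fun_prop) (by fun_prop)] at hzero
  simp only [integral_const_mul] at hzero
  rw [hM 4, hM 3, hM 2, hM₁, hM₀]
  push_cast
  linear_combination 1 / (√(2 * π) * n.factorial) * hzero
end

section
/- (Differential equation for the mixed MGFs.) For every τ ∈ [0,1], every even integer N ≥ 2 and every t ∈ ℝ: ((1−τ)/2)M‴(t) − ((1+τ)(τ²−3τ+1)/2)·t·M″(t) − ((1−τ²)/2)(2τ(1+τ)t² + (N−1)(1+τ) + 2−τ)·M′(t) − (τ(1+τ)²/2)(τ(1+τ)t² + (N−1)(1+τ) + 3−2τ)·t·M(t) = ((1−τ)/2)u‴(t) − ((1+τ)(1−4τ+τ²)/4)·t·u″(t) − (1+τ)( (3τ(1−τ²)/8)t² + ((1−τ²)/2)(N−1) + (1−τ)/2 )·u′(t) − τ(1+τ)²( (τ(1+τ)/8)t² + ((1+τ)/2)(N−1) + (5+τ)/8 )·t·u(t).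 -/
open Real MeasureTheory Finset

/-- Continuous functions of at most exponential growth. -/
def ExpGrowth (h : ℝ → ℝ) : Prop :=
  Continuous h ∧ ∃ K, 0 ≤ K ∧ ∀ x, |h x| ≤ K * Real.exp (K * |x|)

namespace ExpGrowth

variable {h h₁ h₂ : ℝ → ℝ}

lemma const (c : ℝ) : ExpGrowth fun _ => c := by
  refine ⟨continuous_const, |c|, abs_nonneg c, fun x => ?_⟩
  exact le_mul_of_one_le_right (abs_nonneg c) (Real.one_le_exp (by positivity))

lemma id : ExpGrowth fun x => x := by
  refine ⟨continuous_id, 1, zero_le_one, fun x => ?_⟩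
  linarith [Real.add_one_le_exp (1 * |x|)]

lemma exp_mul (t : ℝ) : ExpGrowth fun x => Real.exp (t * x) := by
  refine ⟨by fun_prop, |t| + 1, by positivity, fun x => ?_⟩
  have hx : t * x ≤ (|t| + 1) * |x| := by
    have := le_abs_self (t * x)
    rw [abs_mul] at this
    nlinarith [abs_nonneg x]
  rw [abs_of_pos (Real.exp_pos _)]
  have := Real.exp_le_exp.2 hx
  nlinarith [abs_nonneg t, Real.exp_pos ((|t| + 1) * |x|)]

lemma gaussian {b : ℝ} (hb : 0 < b) : ExpGrowth fun x => Real.exp (-(b * x ^ 2)) := by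
  refine ⟨by fun_prop, 1, zero_le_one, fun x => ?_⟩
  rw [abs_of_pos (Real.exp_pos _), one_mul]
  exact Real.exp_le_exp.2 (by nlinarith [abs_nonneg x, mul_nonneg hb.le (sq_nonneg x)])

lemma add (H₁ : ExpGrowth h₁) (H₂ : ExpGrowth h₂) : ExpGrowth fun x => h₁ x + h₂ x := by
  obtain ⟨c₁, K₁, hK₁, H₁⟩ := H₁
  obtain ⟨c₂, K₂, hK₂, H₂⟩ := H₂
  refine ⟨c₁.add c₂, K₁ + K₂, by positivity, fun x => ?_⟩
  calc |h₁ x + h₂ x| ≤ |h₁ x| + |h₂ x| := abs_add_le _ _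
    _ ≤ K₁ * Real.exp (K₁ * |x|) + K₂ * Real.exp (K₂ * |x|) := add_le_add (H₁ x) (H₂ x)
    _ ≤ K₁ * Real.exp ((K₁ + K₂) * |x|) + K₂ * Real.exp ((K₁ + K₂) * |x|) := by
      gcongr <;> linarith
    _ = _ := by ring

lemma mul (H₁ : ExpGrowth h₁) (H₂ : ExpGrowth h₂) : ExpGrowth fun x => h₁ x * h₂ x := by
  obtain ⟨c₁, K₁, hK₁, H₁⟩ := H₁
  obtain ⟨c₂, K₂, hK₂, H₂⟩ := H₂
  have hK := mul_nonneg hK₁ hK₂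
  refine ⟨c₁.mul c₂, K₁ + K₂ + K₁ * K₂, by positivity, fun x => ?_⟩
  calc |h₁ x * h₂ x| = |h₁ x| * |h₂ x| := abs_mul _ _
    _ ≤ (K₁ * Real.exp (K₁ * |x|)) * (K₂ * Real.exp (K₂ * |x|)) := by
      gcongr
      exacts [H₁ x, H₂ x]
    _ = K₁ * K₂ * Real.exp ((K₁ + K₂) * |x|) := by rw [add_mul, Real.exp_add]; ring
    _ ≤ _ := mul_le_mul (by linarith)
      (Real.exp_le_exp.2 (mul_le_mul_of_nonneg_right (by linarith) (abs_nonneg x))) (by positivity) (by positivity)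

lemma neg (H : ExpGrowth h) : ExpGrowth fun x => -h x := by
  simpa using (const (-1)).mul H

lemma sub (H₁ : ExpGrowth h₁) (H₂ : ExpGrowth h₂) : ExpGrowth fun x => h₁ x - h₂ x := by
  simpa [sub_eq_add_neg] using H₁.add H₂.neg

lemma div_const (H : ExpGrowth h) (c : ℝ) : ExpGrowth fun x => h x / c := by
  simpa only [div_eq_mul_inv] using H.mul (const c⁻¹)

lemma pow (H : ExpGrowth h) (k : ℕ) : ExpGrowth fun x => h x ^ k := by
  induction k with
  | zero => simpa using const 1
  | succ k ih => simpa [pow_succ] using ih.mul H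

lemma sum {ι : Type*} (s : Finset ι) {F : ι → ℝ → ℝ} (H : ∀ i, ExpGrowth (F i)) :
    ExpGrowth fun x => ∑ i ∈ s, F i x := by
  classical
  induction s using Finset.induction_on with
  | empty => simpa using const 0
  | insert i s hi ih => simpa [Finset.sum_insert hi] using (H i).add ih

lemma primitive (H : ExpGrowth h) : ExpGrowth fun x => ∫ y in (0 : ℝ)..x, h y := by
  have hc : Continuous fun x => ∫ y in (0 : ℝ)..x, h y :=
    intervalIntegral.continuous_primitive (fun a b => H.1.intervalIntegrable a b) 0
  obtain ⟨-, K, hK, H⟩ := H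
  refine ⟨hc, K + 1, by positivity, fun x => ?_⟩
  have hbound : ∀ y ∈ Set.uIoc 0 x, ‖h y‖ ≤ K * Real.exp (K * |x|) := fun y hy => by
    have hyx : |y| ≤ |x| := by
      simpa using Set.abs_sub_left_of_mem_uIcc (Set.uIoc_subset_uIcc hy)
    refine (H y).trans ?_
    gcongr
  have hprim := intervalIntegral.norm_integral_le_of_norm_le_const hbound
  rw [Real.norm_eq_abs, sub_zero] at hprim
  refine hprim.trans ?_
  have hx : |x| ≤ Real.exp |x| := by linarith [Real.add_one_le_exp |x|]
  calc K * Real.exp (K * |x|) * |x| ≤ (K + 1) * Real.exp (K * |x|) * Real.exp |x| := by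
        gcongr; linarith
    _ = (K + 1) * Real.exp ((K + 1) * |x|) := by rw [add_mul K 1 |x|, one_mul, Real.exp_add]; ring

lemma integrable (H : ExpGrowth h) {b : ℝ} (hb : 0 < b) :
    Integrable fun x => Real.exp (-(b * x ^ 2)) * h x := by
  obtain ⟨c, K, hK, H⟩ := H
  refine (integrable_inv_one_add_sq.const_mul
    (2 * (K * Real.exp ((K + 1) ^ 2 / (4 * b))))).mono' (by fun_prop) (ae_of_all _ fun x => ?_)
  have hquad : -(b * x ^ 2) + K * |x| + |x| ≤ (K + 1) ^ 2 / (4 * b) := by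
    rw [le_div_iff₀ (by positivity), ← sq_abs x]
    nlinarith [sq_nonneg (2 * b * |x| - (K + 1))]
  have hexp : 1 + x ^ 2 ≤ 2 * Real.exp |x| := by
    have := Real.quadratic_le_exp_of_nonneg (abs_nonneg x)
    rw [sq_abs] at this
    nlinarith [abs_nonneg x]
  rw [← div_eq_mul_inv, le_div_iff₀ (by positivity), Real.norm_eq_abs, abs_mul,
    abs_of_pos (Real.exp_pos _)]
  calc Real.exp (-(b * x ^ 2)) * |h x| * (1 + x ^ 2)
      ≤ Real.exp (-(b * x ^ 2)) * (K * Real.exp (K * |x|)) * (2 * Real.exp |x|) := by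
        gcongr
        exact H x
    _ = 2 * (K * Real.exp (-(b * x ^ 2) + K * |x| + |x|)) := by
        rw [Real.exp_add, Real.exp_add]; ring
    _ ≤ _ := by gcongr

end ExpGrowth

/-- The bilateral Laplace transform of the function `h` times a Gaussian. -/
noncomputable def gaussLaplace (b : ℝ) (h : ℝ → ℝ) (t : ℝ) : ℝ :=
  ∫ x : ℝ, Real.exp (t * x) * (Real.exp (-(b * x ^ 2)) * h x)

section gaussLaplace

variable {b : ℝ} {h h₁ h₂ : ℝ → ℝ}

lemma ExpGrowth.integrable_exp_mul (H : ExpGrowth h) (hb : 0 < b) (t : ℝ) :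
    Integrable fun x => Real.exp (t * x) * (Real.exp (-(b * x ^ 2)) * h x) := by
  refine (((ExpGrowth.exp_mul t).mul H).integrable hb).congr (ae_of_all _ fun x => ?_)
  simp only
  ring

lemma gaussLaplace_add (hb : 0 < b) (H₁ : ExpGrowth h₁) (H₂ : ExpGrowth h₂) (t : ℝ) :
    gaussLaplace b (fun x => h₁ x + h₂ x) t = gaussLaplace b h₁ t + gaussLaplace b h₂ t := by
  rw [gaussLaplace, gaussLaplace, gaussLaplace,
    ← integral_add (H₁.integrable_exp_mul hb t) (H₂.integrable_exp_mul hb t)]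
  simp only [mul_add]

lemma gaussLaplace_const_mul (c t : ℝ) :
    gaussLaplace b (fun x => c * h x) t = c * gaussLaplace b h t := by
  rw [gaussLaplace, gaussLaplace, ← integral_const_mul]
  congr with x
  ring

lemma gaussLaplace_cubic_mul (hb : 0 < b) (H : ExpGrowth h) (c₃ c₂ c₁ c₀ t : ℝ) :
    gaussLaplace b (fun x => (c₃ * x ^ 3 + c₂ * x ^ 2 + c₁ * x + c₀) * h x) t =
      c₃ * gaussLaplace b (fun x => x ^ 3 * h x) t + c₂ * gaussLaplace b (fun x => x ^ 2 * h x) t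
        + c₁ * gaussLaplace b (fun x => x ^ 1 * h x) t + c₀ * gaussLaplace b h t := by
  have Hk (c : ℝ) (k : ℕ) : ExpGrowth fun x => c * (x ^ k * h x) :=
    (ExpGrowth.const c).mul ((ExpGrowth.id.pow k).mul H)
  have H0 : ExpGrowth fun x => c₀ * h x := (ExpGrowth.const c₀).mul H
  rw [← gaussLaplace_const_mul, ← gaussLaplace_const_mul, ← gaussLaplace_const_mul,
    ← gaussLaplace_const_mul, ← gaussLaplace_add hb (Hk _ _) (Hk _ _),
    ← gaussLaplace_add hb ((Hk _ _).add (Hk _ _)) (Hk _ _),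
    ← gaussLaplace_add hb (((Hk _ _).add (Hk _ _)).add (Hk _ _)) H0]
  congr with x
  ring

lemma hasDerivAt_gaussLaplace (hb : 0 < b) (H : ExpGrowth h) (t : ℝ) :
    HasDerivAt (gaussLaplace b h) (gaussLaplace b (fun x => x * h x) t) t := by
  have Hx : ExpGrowth fun x => x * h x := ExpGrowth.id.mul H
  have hbound := ((Hx.integrable_exp_mul hb (|t| + 1)).norm).add
    ((Hx.integrable_exp_mul hb (-(|t| + 1))).norm)
  refine (hasDerivAt_integral_of_dominated_loc_of_deriv_le (Metric.ball_mem_nhds t one_pos)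
    (.of_forall fun s => (H.integrable_exp_mul hb s).aestronglyMeasurable)
    (H.integrable_exp_mul hb t)
    (F' := fun s x => Real.exp (s * x) * (Real.exp (-(b * x ^ 2)) * (x * h x)))
    (Hx.integrable_exp_mul hb t).aestronglyMeasurable
    (ae_of_all _ fun x s hs => ?_) hbound (ae_of_all _ fun x s _ => ?_)).2
  · have hs' : |s| ≤ |t| + 1 := by
      have h1 : |s - t| < 1 := by simpa [Real.dist_eq] using hs
      have h2 := abs_add_le (s - t) t
      rw [sub_add_cancel] at h2
      linarith
    have hexp : Real.exp (s * x) ≤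
        Real.exp ((|t| + 1) * x) + Real.exp (-(|t| + 1) * x) := by
      rcases le_total 0 x with hx | hx
      · have : s * x ≤ (|t| + 1) * x :=
          mul_le_mul_of_nonneg_right ((le_abs_self s).trans hs') hx
        linarith [Real.exp_le_exp.2 this, Real.exp_pos (-(|t| + 1) * x)]
      · have : s * x ≤ -(|t| + 1) * x :=
          mul_le_mul_of_nonpos_right (by linarith [neg_abs_le s]) hx
        linarith [Real.exp_le_exp.2 this, Real.exp_pos ((|t| + 1) * x)]
    simp only [Pi.add_apply, norm_mul, Real.norm_eq_abs, Real.abs_exp]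
    rw [← add_mul]
    gcongr
  · have := ((hasDerivAt_id s).mul_const x).exp.mul_const (Real.exp (-(b * x ^ 2)) * h x)
    refine this.congr_deriv ?_
    simp only [_root_.id]
    ring

lemma iteratedDeriv_gaussLaplace (hb : 0 < b) (H : ExpGrowth h) (k : ℕ) :
    iteratedDeriv k (gaussLaplace b h) = gaussLaplace b (fun x => x ^ k * h x) := by
  induction k with
  | zero => simp
  | succ k ih =>
    funext t
    rw [iteratedDeriv_succ, ih,
      (hasDerivAt_gaussLaplace hb ((ExpGrowth.id.pow k).mul H) t).deriv]
    congr with x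
    ring

end gaussLaplace

section CH

variable (τ : ℝ)

lemma CH_add_two (k : ℕ) (x : ℝ) :
    CH τ (k + 2) x = x * CH τ (k + 1) x - ((k : ℝ) + 1) * τ * CH τ k x := by
  rw [CH]

lemma hasDerivAt_CH_succ (k : ℕ) (x : ℝ) :
    HasDerivAt (CH τ (k + 1)) (((k : ℝ) + 1) * CH τ k x) x := by
  induction k using Nat.twoStepInduction with
  | zero => simpa [CH] using hasDerivAt_id' x
  | one =>
    have h := ((hasDerivAt_id x).mul (hasDerivAt_id x)).sub_const τ
    refine (h.congr_deriv ?_).congr_of_eventuallyEq (.of_forall fun y => ?_)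
    · simp [CH]; ring
    · simp [CH]
  | more k ih0 ih1 =>
    have h := ((hasDerivAt_id x).mul ih1).sub (ih0.const_mul (((k : ℝ) + 1 + 1) * τ))
    refine (h.congr_deriv ?_).congr_of_eventuallyEq (.of_forall fun y => ?_)
    · simp only [_root_.id, CH_add_two]
      push_cast
      ring
    · simp only [CH_add_two τ (k + 1), Pi.sub_apply, Pi.mul_apply, _root_.id]
      push_cast
      ring

lemma hasDerivAt_CH (k : ℕ) (x : ℝ) : HasDerivAt (CH τ k) ((k : ℝ) * CH τ (k - 1) x) x := by
  cases k with
  | zero => simpa [CH] using hasDerivAt_const x (1 : ℝ)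
  | succ k => simpa using hasDerivAt_CH_succ τ k x

lemma CH_succ (k : ℕ) (x : ℝ) :
    CH τ (k + 1) x = x * CH τ k x - τ * ((k : ℝ) * CH τ (k - 1) x) := by
  cases k with
  | zero => simp [CH]
  | succ k => rw [CH_add_two]; push_cast; ring

lemma expGrowth_CH (k : ℕ) : ExpGrowth (CH τ k) := by
  induction k using Nat.twoStepInduction with
  | zero => exact ExpGrowth.const 1
  | one => exact ExpGrowth.id
  | more k ih0 ih1 => exact (ExpGrowth.id.mul ih1).sub ((ExpGrowth.const _).mul ih0)

/-- A Christoffel–Darboux type formula for the derivative of the truncated Mehler sum. -/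
lemma hasDerivAt_sum_CH_sq (hτ : 1 + τ ≠ 0) (m : ℕ) (x : ℝ) :
    HasDerivAt (fun y => ∑ k ∈ range (m + 1), CH τ k y ^ 2 / (k.factorial : ℝ))
      (2 * x / (1 + τ) * ∑ k ∈ range (m + 1), CH τ k x ^ 2 / (k.factorial : ℝ)
        - 2 / (1 + τ) * (CH τ (m + 1) x * CH τ m x / (m.factorial : ℝ))) x := by
  induction m with
  | zero =>
    simp only [zero_add, sum_range_one, CH]
    refine (hasDerivAt_const x _).congr_deriv ?_
    simp
    ring
  | succ m ih =>
    have h := ih.add (((hasDerivAt_CH_succ τ m x).pow 2).div_const ((m + 1).factorial : ℝ))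
    simp only [sum_range_succ _ (m + 1)]
    refine h.congr_deriv ?_
    have hm : (m.factorial : ℝ) ≠ 0 := by positivity
    rw [CH_add_two, Nat.factorial_succ]
    push_cast
    field_simp
    ring

end CH

/-- The combination whose exact derivative yields the differential equation: `f` and `g` solve the
first-order Hermite system, `G` is a primitive of `g`, and `E` one of `-2 c f g`. -/
lemma hasDerivAt_exp_mul_antiderivative {τ n c t x g' : ℝ} {f g G E : ℝ → ℝ} (hτ : 1 + τ ≠ 0)
    (hf : HasDerivAt f (-x / (1 + τ) * f x + n * g x) x) (hg : HasDerivAt g g' x)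
    (hg' : τ * g' = x / (1 + τ) * g x - f x) (hG : HasDerivAt G (g x) x)
    (hE : HasDerivAt E (-2 * c * (f x * g x)) x) :
    HasDerivAt (fun x => Real.exp (t * x) *
      (c * ((-(τ * (1 + τ) ^ 2 * (1 - τ) / 2 + (τ * t + x / (1 + τ)) * ((1 + τ) ^ 2 / 2 *
            ((1 - τ) * x + τ * (1 + τ) * t))) * f x
          + τ * n * ((1 + τ) ^ 2 / 2 * ((1 - τ) * x + τ * (1 + τ) * t)) * g x) * G x
        - τ * (1 + τ) ^ 3 / 4 * f x ^ 2
        - τ ^ 2 * (1 + τ) ^ 3 / 4 * (t - 2 * x / (1 + τ)) * (f x * g x)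
        - τ ^ 2 * n * (1 + τ) ^ 3 / 4 * g x ^ 2)
      - ((1 + τ) * (1 - τ) ^ 2 / 4 * x ^ 2 + 5 / 8 * τ * (1 - τ) * (1 + τ) ^ 2 * t * x
        + 3 / 8 * τ ^ 2 * (1 + τ) ^ 3 * t ^ 2 + τ * (1 + τ) ^ 2 * (1 - 2 * τ) / 4) * E x))
      (Real.exp (t * x) *
        (((1-τ)/2 * x ^ 3 + (-((1+τ)*(τ^2-3*τ+1)/2) * t) * x ^ 2
          + (-((1-τ^2)/2) * (2*τ*(1+τ)*t^2 + n*(1+τ) + 2-τ)) * x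
          + (-(τ*(1+τ)^2/2) * (τ*(1+τ)*t^2 + n*(1+τ) + 3-2*τ) * t)) * (E x + c * (f x * G x))
        - ((1-τ)/2 * x ^ 3 + (-((1+τ)*(1-4*τ+τ^2)/4) * t) * x ^ 2
          + (-(1+τ) * ((3*τ*(1-τ^2)/8)*t^2 + ((1-τ^2)/2)*n + (1-τ)/2)) * x
          + (-(τ*(1+τ)^2) * ((τ*(1+τ)/8)*t^2 + ((1+τ)/2)*n + (5+τ)/8) * t)) * E x)) x := by
  have hx := hasDerivAt_id x
  have hexp := (hx.const_mul t).exp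
  have hk := ((hx.const_mul (1 - τ)).add_const (τ * (1 + τ) * t)).const_mul ((1 + τ) ^ 2 / 2)
  have hf₁ := ((((hx.div_const (1 + τ)).const_add (τ * t)).mul hk).const_add
    (τ * (1 + τ) ^ 2 * (1 - τ) / 2)).neg.mul hf
  have hg₁ := (hk.const_mul (τ * n)).mul hg
  have hfg := ((((hx.const_mul 2).div_const (1 + τ)).const_sub t).const_mul
    (τ ^ 2 * (1 + τ) ^ 3 / 4)).mul (hf.mul hg)
  have hquad := (((((hf₁.add hg₁).mul hG).sub ((hf.pow 2).const_mul (τ * (1 + τ) ^ 3 / 4))).sub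
    hfg).sub ((hg.pow 2).const_mul (τ ^ 2 * n * (1 + τ) ^ 3 / 4))).const_mul c
  have hpoly := ((((hx.pow 2).const_mul ((1 + τ) * (1 - τ) ^ 2 / 4)).add
    (hx.const_mul (5 / 8 * τ * (1 - τ) * (1 + τ) ^ 2 * t))).add_const
    (3 / 8 * τ ^ 2 * (1 + τ) ^ 3 * t ^ 2)).add_const (τ * (1 + τ) ^ 2 * (1 - 2 * τ) / 4)
  have h := hexp.mul (hquad.sub (hpoly.mul hE))
  refine h.congr_deriv ?_
  simp only [_root_.id, Pi.add_apply, Pi.mul_apply, Pi.sub_apply, Pi.neg_apply, Pi.pow_apply]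
  linear_combination (norm := (field_simp; ring)) Real.exp (t * x) * c *
    (n * ((1 + τ) ^ 2 / 2 * ((1 - τ) * x + τ * (1 + τ) * t)) * G x
      - τ * (1 + τ) ^ 3 / 4 * (t - 2 * x / (1 + τ)) * f x - τ * n * (1 + τ) ^ 3 / 2 * g x) * hg'

lemma hasDerivAt_gaussian_mul {τ x q' : ℝ} {p : ℝ → ℝ} (hp : HasDerivAt p q' x) :
    HasDerivAt (fun y => Real.exp (-((2 * (1 + τ))⁻¹ * y ^ 2)) * p y)
      (Real.exp (-((2 * (1 + τ))⁻¹ * x ^ 2)) * (q' - x / (1 + τ) * p x)) x := by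
  have h := ((((hasDerivAt_id x).pow 2).const_mul (2 * (1 + τ))⁻¹).neg.exp).mul hp
  refine h.congr_deriv ?_
  simp only [_root_.id, Pi.pow_apply, Pi.neg_apply]
  field_simp
  ring

lemma expGrowth_sum_CH_sq (τ : ℝ) (m : ℕ) :
    ExpGrowth fun x => ∑ k ∈ range m, CH τ k x ^ 2 / (k.factorial : ℝ) :=
  ExpGrowth.sum _ fun k => ((expGrowth_CH τ k).pow 2).div_const _

/-- **Theorem (Differential equation for the mixed MGFs).**
For every `τ ∈ [0,1]`, every even integer `N ≥ 2` and every `t ∈ ℝ`, the stated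
third-order differential expression in `M` equals the stated one in `u`. -/
theorem mixed_MGF_ODE (τ : ℝ) (hτ : τ ∈ Set.Icc (0:ℝ) 1)
    (N : ℕ) (hNeven : Even N) (hN2 : 2 ≤ N) (t : ℝ) :
    ((1-τ)/2) * iteratedDeriv 3 (MGF τ N) t
    - ((1+τ)*(τ^2-3*τ+1)/2) * t * iteratedDeriv 2 (MGF τ N) t
    - ((1-τ^2)/2) * (2*τ*(1+τ)*t^2 + ((N:ℝ)-1)*(1+τ) + 2-τ) * deriv (MGF τ N) t
    - (τ*(1+τ)^2/2) * (τ*(1+τ)*t^2 + ((N:ℝ)-1)*(1+τ) + 3-2*τ) * t * MGF τ N t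
    = ((1-τ)/2) * iteratedDeriv 3 (uF τ N) t
    - ((1+τ)*(1-4*τ+τ^2)/4) * t * iteratedDeriv 2 (uF τ N) t
    - (1+τ) * ((3*τ*(1-τ^2)/8)*t^2 + ((1-τ^2)/2)*((N:ℝ)-1) + (1-τ)/2) * deriv (uF τ N) t
    - τ*(1+τ)^2 * ((τ*(1+τ)/8)*t^2 + ((1+τ)/2)*((N:ℝ)-1) + (5+τ)/8) * t * uF τ N t := by
  obtain ⟨m, rfl⟩ : ∃ m, N = m + 2 := ⟨N - 2, by omega⟩
  have ha : 0 < 1 + τ := by linarith [hτ.1]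
  set b : ℝ := (2 * (1 + τ))⁻¹ with hb_def
  have hb : 0 < b := by positivity
  set c : ℝ := 1 / ((1 + τ) * (m.factorial : ℝ)) / Real.sqrt (2 * Real.pi) with hc
  set W : ℝ → ℝ := fun x => Real.exp (-(b * x ^ 2)) with hW
  set f : ℝ → ℝ := fun x => W x * CH τ (m + 1) x with hf
  set g : ℝ → ℝ := fun x => W x * CH τ m x with hg
  set G : ℝ → ℝ := fun x => ∫ y in (0 : ℝ)..x, g y with hG
  set S : ℝ → ℝ := fun x => ∑ k ∈ range (m + 1), CH τ k x ^ 2 / (k.factorial : ℝ) with hS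
  set U : ℝ → ℝ := fun x => W x * (S x / Real.sqrt (2 * Real.pi)) with hU
  set V : ℝ → ℝ := fun x => U x + c * (CH τ (m + 1) x * G x) with hV
  have hπ : Real.sqrt (2 * Real.pi) ≠ 0 := by positivity
  have hWexp (x : ℝ) : Real.exp (-x ^ 2 / (2 * (1 + τ))) = W x := by
    simp only [hW, hb_def]; congr 1; ring
  have hR1 : R1 τ (m + 2) = fun x => W x * U x := by
    funext x
    have hsq : Real.exp (-x ^ 2 / (1 + τ)) = W x * W x := by
      simp only [hW, hb_def, ← Real.exp_add]; congr 1; field_simp; ring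
    simp only [R1, hsq, hU, hS, show m + 2 - 1 = m + 1 by omega]
    ring
  have hR : Rd τ (m + 2) = fun x => W x * V x := by
    funext x
    simp only [Rd, R2, hWexp, congrFun hR1 x, hV, hG, hg, hc, show m + 2 - 1 = m + 1 by omega,
      show m + 2 - 2 = m by omega]
    ring
  have huF : uF τ (m + 2) = gaussLaplace b U := by
    funext s; simp only [uF, hR1, gaussLaplace, hW]
  have hMGF : MGF τ (m + 2) = gaussLaplace b V := by
    funext s; simp only [MGF, hR, gaussLaplace, hW]
  have eW : ExpGrowth W := ExpGrowth.gaussian hb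
  have eg : ExpGrowth g := eW.mul (expGrowth_CH τ m)
  have eG : ExpGrowth G := eg.primitive
  have eU : ExpGrowth U := eW.mul ((expGrowth_sum_CH_sq τ (m + 1)).div_const _)
  have eV : ExpGrowth V := eU.add ((ExpGrowth.const c).mul ((expGrowth_CH τ (m + 1)).mul eG))
  rw [hMGF, huF, ← iteratedDeriv_one, ← iteratedDeriv_one]
  simp only [iteratedDeriv_gaussLaplace hb eU, iteratedDeriv_gaussLaplace hb eV]
  have hn : ((m + 2 : ℕ) : ℝ) - 1 = (m : ℝ) + 1 := by push_cast; ring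
  rw [hn]
  set n : ℝ := (m : ℝ) + 1
  have ep := expGrowth_CH τ (m + 1)
  have eq' := expGrowth_CH τ m
  have dG (x : ℝ) : HasDerivAt G (g x) x := (eg.1.integral_hasStrictDerivAt 0 x).hasDerivAt
  have df (x : ℝ) : HasDerivAt f (-x / (1 + τ) * f x + n * g x) x := by
    refine (hasDerivAt_gaussian_mul (hasDerivAt_CH_succ τ m x)).congr_deriv ?_
    simp only [hf, hg, hW, n, hb_def]
    ring
  have dg (x : ℝ) := hasDerivAt_gaussian_mul (τ := τ) (hasDerivAt_CH τ m x)
  have dE (x : ℝ) : HasDerivAt (fun y => W y * U y) (-2 * c * (f x * g x)) x := by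
    have hS' := (hasDerivAt_sum_CH_sq τ ha.ne' m x).div_const (Real.sqrt (2 * Real.pi))
    refine (hasDerivAt_gaussian_mul (τ := τ) (hasDerivAt_gaussian_mul (τ := τ) hS')).congr_deriv ?_
    simp only [hf, hg, hW, hc, ← hb_def]
    have hm : (m.factorial : ℝ) ≠ 0 := by positivity
    field_simp
    ring
  have dH (x : ℝ) := hasDerivAt_exp_mul_antiderivative (t := t) ha.ne' (df x) (dg x) (by
    simp only [hf, hg, hW, ← hb_def, CH_succ τ m x]
    field_simp
    ring) (dG x) (dE x)
  have hα := gaussLaplace_cubic_mul hb eV ((1-τ)/2) (-((1+τ)*(τ^2-3*τ+1)/2) * t)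
    (-((1-τ^2)/2) * (2*τ*(1+τ)*t^2 + n*(1+τ) + 2-τ))
    (-(τ*(1+τ)^2/2) * (τ*(1+τ)*t^2 + n*(1+τ) + 3-2*τ) * t) t
  have hβ := gaussLaplace_cubic_mul hb eU ((1-τ)/2) (-((1+τ)*(1-4*τ+τ^2)/4) * t)
    (-(1+τ) * ((3*τ*(1-τ^2)/8)*t^2 + ((1-τ^2)/2)*n + (1-τ)/2))
    (-(τ*(1+τ)^2) * ((τ*(1+τ)/8)*t^2 + ((1+τ)/2)*n + (5+τ)/8) * t) t
  have ecubic (c₃ c₂ c₁ c₀ : ℝ) : ExpGrowth fun x => c₃ * x ^ 3 + c₂ * x ^ 2 + c₁ * x + c₀ := by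
    repeat' first
      | exact .const _ | exact .id | apply ExpGrowth.add | apply ExpGrowth.mul
  have iα := ((ecubic ((1-τ)/2) (-((1+τ)*(τ^2-3*τ+1)/2) * t)
    (-((1-τ^2)/2) * (2*τ*(1+τ)*t^2 + n*(1+τ) + 2-τ))
    (-(τ*(1+τ)^2/2) * (τ*(1+τ)*t^2 + n*(1+τ) + 3-2*τ) * t)).mul eV).integrable_exp_mul hb t
  have iβ := ((ecubic ((1-τ)/2) (-((1+τ)*(1-4*τ+τ^2)/4) * t)
    (-(1+τ) * ((3*τ*(1-τ^2)/8)*t^2 + ((1-τ^2)/2)*n + (1-τ)/2))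
    (-(τ*(1+τ)^2) * ((τ*(1+τ)/8)*t^2 + ((1+τ)/2)*n + (5+τ)/8) * t)).mul eU).integrable_exp_mul hb t
  have eH : ExpGrowth fun x =>
      c * ((-(τ * (1 + τ) ^ 2 * (1 - τ) / 2 + (τ * t + x / (1 + τ)) * ((1 + τ) ^ 2 / 2 *
            ((1 - τ) * x + τ * (1 + τ) * t))) * CH τ (m + 1) x
          + τ * n * ((1 + τ) ^ 2 / 2 * ((1 - τ) * x + τ * (1 + τ) * t)) * CH τ m x) * G x
        - τ * (1 + τ) ^ 3 / 4 * (W x * CH τ (m + 1) x ^ 2)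
        - τ ^ 2 * (1 + τ) ^ 3 / 4 * (t - 2 * x / (1 + τ)) * (W x * (CH τ (m + 1) x * CH τ m x))
        - τ ^ 2 * n * (1 + τ) ^ 3 / 4 * (W x * CH τ m x ^ 2))
      - ((1 + τ) * (1 - τ) ^ 2 / 4 * x ^ 2 + 5 / 8 * τ * (1 - τ) * (1 + τ) ^ 2 * t * x
        + 3 / 8 * τ ^ 2 * (1 + τ) ^ 3 * t ^ 2 + τ * (1 + τ) ^ 2 * (1 - 2 * τ) / 4) * U x := by
    repeat' first
      | exact .const _ | exact .id | exact eW | exact eU | exact eG | exact ep | exact eq'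
      | apply ExpGrowth.add | apply ExpGrowth.sub | apply ExpGrowth.mul | apply ExpGrowth.neg
  have hzero := integral_eq_zero_of_hasDerivAt_of_integrable dH
    ((iα.sub iβ).congr (ae_of_all _ fun x => by
      simp only [Pi.sub_apply, hV, hf, hW]; ring))
    ((eH.integrable_exp_mul hb t).congr (ae_of_all _ fun x => by
      simp only [hf, hg, hW]; ring))
  have hsub := integral_sub iα iβ
  have hdiff := hsub.symm.trans ((integral_congr_ae (ae_of_all _ fun x => by
      simp only [hV, hf, hW]; ring)).trans hzero)
  change gaussLaplace b _ t - gaussLaplace b _ t = 0 at hdiff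
  rw [hα, hβ] at hdiff
  linear_combination hdiff
end
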